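/- arXiv:1603.07377 — 2 statements merged into one kernel-verified Lean document; each statement's English description precedes it below -/
import Mathlib

section
/- Suppose P(|G| ≤ t) = O(t) as t → 0 and E[G²] < ∞. Then for every q ∈ (1,2): lim_{σ → 0} χ*_q(σ)/σ^{2q−2} = (1−ε)·E|Z|^q / (ε·q·E|G|^{2q−2}). -/
open MeasureTheory ProbabilityTheory Real Filter Set Asymptotics

noncomputable section

/-- The standard Gaussian measure on `ℝ`. -/
def stdGaussian : Measure ℝ := gaussianReal 0 1

/-- `IsProx q χ u v` : `v` minimizes `z ↦ (1/2)(u−z)² + χ|z|^q`,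
i.e. `v = η_q(u;χ)` is the proximal operator of `χ|·|^q` at `u`. -/
def IsProx (q χ u v : ℝ) : Prop :=
  ∀ z : ℝ, (1/2) * (u - v)^2 + χ * |v| ^ q ≤ (1/2) * (u - z)^2 + χ * |z| ^ q

/-- The law of `B`: the mixture `(1−ε)δ₀ + ε·g`. -/
def mix (ε : ℝ) (g : Measure ℝ) : Measure ℝ :=
  ENNReal.ofReal (1 - ε) • Measure.dirac (0:ℝ) + ENNReal.ofReal ε • g

/-- `R_q(χ,σ) = E[(η(B/σ+Z;χ) − B/σ)²]` with `B ~ μB`, `Z ~ N(0,1)` independent. -/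
def Rq (η : ℝ → ℝ → ℝ) (μB : Measure ℝ) (χ σ : ℝ) : ℝ :=
  ∫ b, (∫ z, (η (b/σ + z) χ - b/σ)^2 ∂stdGaussian) ∂μB

open scoped Topology

/-- The derivative `q|x|^(q-2)x` of `x ↦ |x|^q`. -/
def powDeriv (q x : ℝ) : ℝ := q * |x| ^ (q - 2) * x

lemma abs_powDeriv {q : ℝ} (hq : 1 < q) (x : ℝ) : |powDeriv q x| = q * |x| ^ (q - 1) := by
  rcases eq_or_ne x 0 with rfl | hx
  · simp [powDeriv, Real.zero_rpow (sub_ne_zero.2 hq.ne')]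
  · have hx' : 0 < |x| := abs_pos.2 hx
    rw [powDeriv, abs_mul, abs_of_nonneg (by positivity : 0 ≤ q * |x| ^ (q - 2)), mul_assoc,
      ← Real.rpow_add_one hx'.ne']
    ring_nf

lemma abs_powDeriv_le {q : ℝ} (hq1 : 1 < q) (hq2 : q < 2) (x : ℝ) :
    |powDeriv q x| ≤ q * (1 + |x|) := by
  rw [abs_powDeriv hq1]
  gcongr
  calc |x| ^ (q - 1) ≤ (1 + |x|) ^ (q - 1) := by
        gcongr
        · linarith
    _ ≤ (1 + |x|) ^ (1 : ℝ) := by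
        apply Real.rpow_le_rpow_of_exponent_le <;> linarith [abs_nonneg x]
    _ = 1 + |x| := Real.rpow_one _

lemma powDeriv_mul_self {q : ℝ} (hq : 1 < q) (x : ℝ) : x * powDeriv q x = q * |x| ^ q := by
  rcases eq_or_ne x 0 with rfl | hx
  · simp [powDeriv, Real.zero_rpow (by linarith : q ≠ 0)]
  · have h := Real.rpow_add_natCast (abs_pos.2 hx).ne' (q - 2) 2
    rw [powDeriv, show q = q - 2 + (2 : ℕ) by push_cast; ring, h, sq_abs]
    push_cast
    ring_nf

lemma powDeriv_sq {q : ℝ} (hq : 1 < q) (x : ℝ) :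
    powDeriv q x ^ 2 = q ^ 2 * |x| ^ (2 * q - 2) := by
  rw [← sq_abs, abs_powDeriv hq, mul_pow, ← Real.rpow_mul_natCast (abs_nonneg x)]
  congr 2
  push_cast
  ring

lemma powDeriv_mul {q c : ℝ} (hc : 0 < c) (x : ℝ) :
    powDeriv q (c * x) = c ^ (q - 1) * powDeriv q x := by
  rw [powDeriv, powDeriv, abs_mul, abs_of_pos hc, Real.mul_rpow hc.le (abs_nonneg x),
    show q - 1 = q - 2 + 1 by ring, Real.rpow_add_one hc.ne']
  ring

lemma powDeriv_monotone {q : ℝ} (hq : 1 < q) : Monotone (powDeriv q) := by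
  refine monotone_of_odd_of_monotoneOn_nonneg (fun x => by simp [powDeriv]) ?_
  have key : ∀ x, 0 ≤ x → powDeriv q x = q * x ^ (q - 1) := fun x hx => by
    have h := abs_powDeriv hq x
    rwa [abs_of_nonneg hx, abs_of_nonneg (by unfold powDeriv; positivity)] at h
  intro x hx y hy hxy
  rw [key x hx, key y hy]
  have : (0 : ℝ) ≤ x := hx
  gcongr

lemma abs_powDeriv_sub_le {q : ℝ} (hq1 : 1 < q) (hq2 : q < 2) (x : ℝ) {y : ℝ} (hy : y ≠ 0) :
    |powDeriv q x - powDeriv q y| ≤ 2 * q * |x - y| * |y| ^ (q - 2) := by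
  have hc : 0 < |y| := abs_pos.2 hy
  have hcr : 0 < |y| ^ (q - 2) := by positivity
  have key : |(|x| ^ (q - 2) - |y| ^ (q - 2)) * x| ≤ |y| ^ (q - 2) * |x - y| := by
    rw [abs_mul]
    rcases eq_or_ne x 0 with rfl | hx
    · simp; positivity
    have ha : 0 < |x| := abs_pos.2 hx
    have e1 : |x| ^ (q - 2) * |x| = |x| ^ (q - 1) := by
      rw [← Real.rpow_add_one ha.ne']; ring_nf
    have e2 : |y| ^ (q - 2) * |y| = |y| ^ (q - 1) := by
      rw [← Real.rpow_add_one hc.ne']; ring_nf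
    rcases le_total |y| |x| with h | h
    · have h1 : |x| ^ (q - 2) ≤ |y| ^ (q - 2) :=
        Real.rpow_le_rpow_of_nonpos hc h (by linarith)
      have h2 : |y| ^ (q - 1) ≤ |x| ^ (q - 1) := by gcongr
      have h3 := mul_le_mul_of_nonneg_left (abs_sub_abs_le_abs_sub x y) hcr.le
      rw [abs_of_nonpos (by linarith)]
      nlinarith
    · have h1 : |y| ^ (q - 2) ≤ |x| ^ (q - 2) :=
        Real.rpow_le_rpow_of_nonpos ha h (by linarith)
      have h2 : |x| ^ (q - 1) ≤ |y| ^ (q - 1) := by gcongr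
      have h3 := mul_le_mul_of_nonneg_left (abs_sub_abs_le_abs_sub y x) hcr.le
      rw [abs_sub_comm y x] at h3
      rw [abs_of_nonneg (by linarith)]
      nlinarith
  have e : powDeriv q x - powDeriv q y
      = q * (|y| ^ (q - 2) * (x - y) + (|x| ^ (q - 2) - |y| ^ (q - 2)) * x) := by
    unfold powDeriv; ring
  rw [e, abs_mul, abs_of_pos (by linarith : 0 < q)]
  calc q * |_| ≤ q * (|y| ^ (q - 2) * |x - y| + |y| ^ (q - 2) * |x - y|) := by
        gcongr
        refine (abs_add_le _ _).trans (add_le_add ?_ key)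
        rw [abs_mul, abs_of_pos hcr]
    _ = _ := by ring

lemma abs_powDeriv_sub_le_rpow {q : ℝ} (hq1 : 1 < q) (hq2 : q < 2) (x y : ℝ) :
    |powDeriv q x - powDeriv q y| ≤ 3 * q * |x - y| ^ (q - 1) := by
  rcases eq_or_ne x y with rfl | hxy
  · simp [Real.zero_rpow (sub_ne_zero.2 hq1.ne')]
  have hd : 0 < |x - y| := abs_pos.2 (sub_ne_zero.2 hxy)
  have hdp : 0 < |x - y| ^ (q - 1) := by positivity
  rcases le_or_gt |x - y| |y| with h | h
  · have hy : y ≠ 0 := abs_pos.1 (hd.trans_le h)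
    have h1 : |y| ^ (q - 2) ≤ |x - y| ^ (q - 2) :=
      Real.rpow_le_rpow_of_nonpos hd h (by linarith)
    have e1 : |x - y| ^ (q - 2) * |x - y| = |x - y| ^ (q - 1) := by
      rw [← Real.rpow_add_one hd.ne']; ring_nf
    calc _ ≤ 2 * q * |x - y| * |y| ^ (q - 2) := abs_powDeriv_sub_le hq1 hq2 x hy
      _ ≤ 2 * q * |x - y| * |x - y| ^ (q - 2) := by gcongr
      _ = 2 * q * |x - y| ^ (q - 1) := by rw [← e1]; ring
      _ ≤ _ := by gcongr; norm_num
  · have hx : |x| ≤ 2 * |x - y| := by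
      have := abs_sub_abs_le_abs_sub x y
      linarith
    have hx' : |x| ^ (q - 1) ≤ 2 * |x - y| ^ (q - 1) := by
      calc |x| ^ (q - 1) ≤ (2 * |x - y|) ^ (q - 1) := by gcongr
        _ = 2 ^ (q - 1) * |x - y| ^ (q - 1) := Real.mul_rpow (by norm_num) hd.le
        _ ≤ 2 ^ (1 : ℝ) * |x - y| ^ (q - 1) := by
          gcongr
          · norm_num
          · linarith
        _ = _ := by rw [Real.rpow_one]
    have hy' : |y| ^ (q - 1) ≤ |x - y| ^ (q - 1) := by gcongr
    calc _ ≤ |powDeriv q x| + |powDeriv q y| := abs_sub _ _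
      _ = q * (|x| ^ (q - 1) + |y| ^ (q - 1)) := by
        rw [abs_powDeriv hq1, abs_powDeriv hq1]; ring
      _ ≤ q * (2 * |x - y| ^ (q - 1) + |x - y| ^ (q - 1)) := by gcongr
      _ = _ := by ring

lemma continuous_powDeriv {q : ℝ} (hq1 : 1 < q) (hq2 : q < 2) : Continuous (powDeriv q) := by
  refine continuous_iff_continuousAt.2 fun y => tendsto_iff_dist_tendsto_zero.2 ?_
  have h : Continuous fun x : ℝ => 3 * q * |x - y| ^ (q - 1) :=
    continuous_const.mul ((continuous_id.sub continuous_const).abs.rpow_const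
      fun _ => Or.inr (by linarith))
  have h0 := h.tendsto y
  simp only [sub_self, abs_zero, Real.zero_rpow (sub_ne_zero.2 hq1.ne'), mul_zero] at h0
  exact squeeze_zero (fun _ => dist_nonneg) (fun x => abs_powDeriv_sub_le_rpow hq1 hq2 x y) h0

namespace IsProx

variable {q χ u u' v v' : ℝ}

lemma eq_add (hq : 1 < q) (h : IsProx q χ u v) : u = v + χ * powDeriv q v := by
  have hd : HasDerivAt (fun z : ℝ => (1 / 2) * (u - z) ^ 2 + χ * |z| ^ q)
      ((1 / 2) * (2 * (u - v) * (-1)) + χ * powDeriv q v) v := by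
    have h1 : HasDerivAt (fun z : ℝ => (u - z) ^ 2) (2 * (u - v) * (-1)) v := by
      refine (((hasDerivAt_id v).const_sub u).pow 2).congr_deriv ?_
      simp
    exact (h1.const_mul _).add ((hasDerivAt_abs_rpow v hq).const_mul χ)
  have := IsLocalMin.hasDerivAt_eq_zero (f := fun z : ℝ => (1 / 2) * (u - z) ^ 2 + χ * |z| ^ q)
    (Filter.Eventually.of_forall h) hd
  linarith

lemma abs_sub_le (hq : 1 < q) (hχ : 0 ≤ χ) (h : IsProx q χ u v) (h' : IsProx q χ u' v') :
    |v - v'| ≤ |u - u'| := by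
  have e := h.eq_add hq
  have e' := h'.eq_add hq
  rcases le_total v v' with hv | hv
  · have := mul_le_mul_of_nonneg_left (powDeriv_monotone hq hv) hχ
    rw [abs_of_nonpos (by linarith), abs_of_nonpos (by linarith)]
    linarith
  · have := mul_le_mul_of_nonneg_left (powDeriv_monotone hq hv) hχ
    rw [abs_of_nonneg (by linarith), abs_of_nonneg (by linarith)]
    linarith

lemma zero (hq : 0 < q) (hχ : 0 ≤ χ) : IsProx q χ 0 0 := fun z => by
  simp only [sub_self, abs_zero, Real.zero_rpow hq.ne']
  have : 0 ≤ χ * |z| ^ q := by positivity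
  nlinarith [sq_nonneg (0 - z)]

lemma abs_le (hq : 1 < q) (hχ : 0 ≤ χ) (h : IsProx q χ u v) : |v| ≤ |u| := by
  simpa using h.abs_sub_le hq hχ (IsProx.zero (by linarith) hχ)

lemma le_abs_mul_powDeriv {δ : ℝ} (hq : 1 < q) (hχ : 0 ≤ χ) (hδ : δ ≤ χ) (h : IsProx q χ u v) :
    min (δ * (q * (|u| / 2) ^ (q - 1))) (|u| / 2) ≤ |χ * powDeriv q v| := by
  have hu : |u| ≤ |v| + |χ * powDeriv q v| := by
    conv_lhs => rw [h.eq_add hq]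
    exact abs_add_le _ _
  rcases le_total (|u| / 2) |v| with hv | hv
  · refine (min_le_left _ _).trans ?_
    rw [abs_mul, abs_of_nonneg hχ, abs_powDeriv hq]
    gcongr
  · exact (min_le_right _ _).trans (by linarith)

end IsProx

instance : IsProbabilityMeasure _root_.stdGaussian := by
  unfold _root_.stdGaussian; infer_instance

lemma memLp_two_stdGaussian : MemLp (fun z : ℝ => z) 2 _root_.stdGaussian :=
  memLp_id_gaussianReal 2

lemma isProbabilityMeasure_mix {ε : ℝ} (hε : ε ∈ Icc (0 : ℝ) 1) (g : Measure ℝ)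
    [IsProbabilityMeasure g] : IsProbabilityMeasure (mix ε g) := by
  refine ⟨?_⟩
  simp only [mix, Measure.coe_add, Measure.coe_smul, Pi.add_apply, Pi.smul_apply, measure_univ,
    smul_eq_mul, mul_one]
  rw [← ENNReal.ofReal_add (by linarith [hε.2]) hε.1]
  simp

lemma integrable_mix {ε : ℝ} {g : Measure ℝ} {f : ℝ → ℝ} (hf : Integrable f g) :
    Integrable f (mix ε g) :=
  ((integrable_dirac (by simp)).smul_measure (by simp)).add_measure
    (hf.smul_measure (by simp))

lemma integral_mix {ε : ℝ} (hε : ε ∈ Icc (0 : ℝ) 1) {g : Measure ℝ} {f : ℝ → ℝ}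
    (hf : Integrable f g) : ∫ b, f b ∂(mix ε g) = (1 - ε) * f 0 + ε * ∫ b, f b ∂g := by
  rw [mix, integral_add_measure ((integrable_dirac (by simp)).smul_measure (by simp))
    (hf.smul_measure (by simp)), integral_smul_measure, integral_smul_measure, integral_dirac,
    ENNReal.toReal_ofReal (by linarith [hε.2]), ENNReal.toReal_ofReal hε.1]
  rfl

/-- The joint law of `(B, Z)`. -/
def jointLaw (ε : ℝ) (g : Measure ℝ) : Measure (ℝ × ℝ) := (mix ε g).prod _root_.stdGaussian

section Joint

variable {ε : ℝ} {g : Measure ℝ}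

lemma memLp_fst_jointLaw (hG2 : Integrable (fun x => x ^ 2) g) :
    MemLp (fun p : ℝ × ℝ => p.1) 2 (jointLaw ε g) := by
  have h : MemLp (fun b : ℝ => b) 2 (mix ε g) :=
    (memLp_two_iff_integrable_sq aestronglyMeasurable_id).2 (integrable_mix hG2)
  exact h.comp_fst _

variable [IsProbabilityMeasure g]

lemma isProbabilityMeasure_jointLaw (hε : ε ∈ Icc (0 : ℝ) 1) :
    IsProbabilityMeasure (jointLaw ε g) := by
  have := isProbabilityMeasure_mix hε g
  unfold jointLaw
  infer_instance

lemma memLp_snd_jointLaw (hε : ε ∈ Icc (0 : ℝ) 1) :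
    MemLp (fun p : ℝ × ℝ => p.2) 2 (jointLaw ε g) := by
  have := isProbabilityMeasure_mix hε g
  exact memLp_two_stdGaussian.comp_snd _

lemma integral_ite_jointLaw (hε : ε ∈ Icc (0 : ℝ) 1) (hg0 : g {0} = 0) {f : ℝ → ℝ}
    (hfm : Measurable f) (hf : Integrable f _root_.stdGaussian) (k : ℝ) :
    ∫ p, (if p.1 = 0 then f p.2 else k) ∂(jointLaw ε g)
      = (1 - ε) * ∫ z, f z ∂_root_.stdGaussian + ε * k := by
  have := isProbabilityMeasure_mix hε g
  have hm : Measurable fun p : ℝ × ℝ => if p.1 = 0 then f p.2 else k :=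
    Measurable.ite (measurable_fst (measurableSet_singleton 0)) (hfm.comp measurable_snd)
      measurable_const
  have hint : Integrable (fun p : ℝ × ℝ => if p.1 = 0 then f p.2 else k)
      ((mix ε g).prod _root_.stdGaussian) := by
    refine Integrable.mono' ((hf.norm.comp_snd (mix ε g)).add (integrable_const |k|))
      hm.aestronglyMeasurable (Filter.Eventually.of_forall fun p => ?_)
    simp only [Pi.add_apply, Real.norm_eq_abs]
    split_ifs
    · linarith [abs_nonneg k]
    · linarith [abs_nonneg (f p.2)]
  have hae : ∀ᵐ b ∂g, (if b = 0 then ∫ z, f z ∂_root_.stdGaussian else k) = k := by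
    have : ∀ᵐ b ∂g, b ≠ 0 := by
      rw [ae_iff]; simpa using hg0
    filter_upwards [this] with b hb using if_neg hb
  have hinner : ∀ b : ℝ, ∫ z, (if b = 0 then f z else k) ∂_root_.stdGaussian
      = if b = 0 then ∫ z, f z ∂_root_.stdGaussian else k := fun b => by
    split_ifs <;> simp
  rw [jointLaw, integral_prod _ hint]
  simp only [hinner]
  rw [integral_mix hε ((integrable_const k).congr (hae.mono fun b hb => hb.symm)),
    integral_congr_ae hae]
  simp

variable {q χ σ : ℝ} {e : ℝ → ℝ}

lemma continuous_of_isProx (hq : 1 < q) (hχ : 0 ≤ χ) (he : ∀ u, IsProx q χ u (e u)) :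
    Continuous e :=
  (LipschitzWith.of_dist_le_mul (K := 1) fun u v => by
    simpa [Real.dist_eq] using (he u).abs_sub_le hq hχ (he v)).continuous

lemma memLp_powDeriv_isProx (hq1 : 1 < q) (hq2 : q < 2) (hε : ε ∈ Icc (0 : ℝ) 1)
    (hχ : 0 ≤ χ) (he : ∀ u, IsProx q χ u (e u))
    {u : ℝ × ℝ → ℝ} (hu : MemLp u 2 (jointLaw ε g)) :
    MemLp (fun p => powDeriv q (e (u p))) 2 (jointLaw ε g) := by
  have := isProbabilityMeasure_jointLaw (g := g) hε
  refine MemLp.of_le (((memLp_const (1 : ℝ)).add hu.abs).const_mul q)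
    (((continuous_powDeriv hq1 hq2).comp
      (continuous_of_isProx hq1 hχ he)).comp_aestronglyMeasurable hu.1)
    (Filter.Eventually.of_forall fun p => ?_)
  simp only [Real.norm_eq_abs, Pi.add_apply]
  refine (abs_powDeriv_le hq1 hq2 _).trans (le_trans ?_ (le_abs_self _))
  gcongr
  exact (he _).abs_le hq1 hχ

lemma memLp_shift (hε : ε ∈ Icc (0 : ℝ) 1) (hG2 : Integrable (fun x => x ^ 2) g) (σ : ℝ) :
    MemLp (fun p : ℝ × ℝ => p.1 / σ + p.2) 2 (jointLaw ε g) := by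
  have := ((memLp_fst_jointLaw (ε := ε) hG2).const_mul σ⁻¹).add
    (memLp_snd_jointLaw (g := g) hε)
  refine this.congr_norm ?_ (Filter.Eventually.of_forall fun p => ?_)
  · exact (by fun_prop : Continuous fun p : ℝ × ℝ => p.1 / σ + p.2).aestronglyMeasurable
  · simp [div_eq_inv_mul]

variable {η : ℝ → ℝ → ℝ}

lemma Rq_eq_integral (hq1 : 1 < q) (hq2 : q < 2) (hε : ε ∈ Icc (0 : ℝ) 1)
    (hG2 : Integrable (fun x => x ^ 2) g) (hχ : 0 ≤ χ) (hη : ∀ u, IsProx q χ u (η u χ)) :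
    Rq η (mix ε g) χ σ
      = ∫ p, (p.2 - χ * powDeriv q (η (p.1 / σ + p.2) χ)) ^ 2 ∂(jointLaw ε g) := by
  have := isProbabilityMeasure_mix hε g
  have hint := ((memLp_snd_jointLaw (g := g) hε).sub
    ((memLp_powDeriv_isProx hq1 hq2 hε hχ hη (memLp_shift hε hG2 σ)).const_mul χ)).integrable_sq
  simp only [Pi.sub_apply] at hint
  rw [jointLaw] at hint ⊢
  rw [integral_prod _ hint, Rq]
  congr! 5 with b z
  linarith [(hη (b / σ + z)).eq_add hq1]

lemma Rq_expand (hq1 : 1 < q) (hq2 : q < 2) (hε : ε ∈ Icc (0 : ℝ) 1)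
    (hG2 : Integrable (fun x => x ^ 2) g) (hχ : 0 ≤ χ) (hη : ∀ u, IsProx q χ u (η u χ)) :
    Rq η (mix ε g) χ σ
      = ∫ p, p.2 ^ 2 ∂(jointLaw ε g)
        - 2 * χ * ∫ p, p.2 * powDeriv q (η (p.1 / σ + p.2) χ) ∂(jointLaw ε g)
        + χ ^ 2 * ∫ p, powDeriv q (η (p.1 / σ + p.2) χ) ^ 2 ∂(jointLaw ε g) := by
  have hz := memLp_snd_jointLaw (g := g) hε
  have hψ := memLp_powDeriv_isProx hq1 hq2 hε hχ hη (memLp_shift hε hG2 σ)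
  have h2 : Integrable (fun p : ℝ × ℝ => p.2 * powDeriv q (η (p.1 / σ + p.2) χ))
      (jointLaw ε g) := hz.integrable_mul hψ
  have h3 : Integrable (fun p : ℝ × ℝ =>
      p.2 ^ 2 - 2 * χ * (p.2 * powDeriv q (η (p.1 / σ + p.2) χ))) (jointLaw ε g) :=
    hz.integrable_sq.sub (h2.const_mul _)
  rw [Rq_eq_integral hq1 hq2 hε hG2 hχ hη, ← integral_const_mul, ← integral_const_mul,
    ← integral_sub hz.integrable_sq (h2.const_mul _),
    ← integral_add h3 (hψ.integrable_sq.const_mul _)]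
  congr! 2 with p
  ring

variable {c : ℝ → ℝ}

lemma tendsto_mul_prox (hq1 : 1 < q) (hq2 : q < 2) (hη : ∀ u χ, 0 ≤ χ → IsProx q χ u (η u χ))
    (hc0 : ∀ᶠ σ in 𝓝[>] (0 : ℝ), 0 ≤ c σ) (hc : Tendsto c (𝓝[>] (0 : ℝ)) (𝓝 0)) (b z : ℝ) :
    Tendsto (fun σ => σ * η (b / σ + z) (c σ)) (𝓝[>] (0 : ℝ)) (𝓝 b) := by
  have hσ : Tendsto (fun σ : ℝ => σ) (𝓝[>] (0 : ℝ)) (𝓝 0) := tendsto_nhdsWithin_of_tendsto_nhds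
    tendsto_id
  have hlim : Tendsto (fun σ => c σ * (q * (σ + (|b| + σ * |z|))) + σ * |z|)
      (𝓝[>] (0 : ℝ)) (𝓝 0) := by
    have := (hc.mul ((hσ.add ((tendsto_const_nhds (x := |b|)).add
      (hσ.mul_const |z|))).const_mul q)).add (hσ.mul_const |z|)
    simpa using this
  refine tendsto_iff_dist_tendsto_zero.2 (squeeze_zero' (Filter.Eventually.of_forall
    fun _ => dist_nonneg) ?_ hlim)
  filter_upwards [hc0, self_mem_nhdsWithin] with σ h0 hpos
  have hpos : 0 < σ := hpos
  have hp := hη (b / σ + z) (c σ) h0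
  set v := η (b / σ + z) (c σ)
  have e : σ * v - b = -(c σ * (σ * powDeriv q v)) + σ * z := by
    have h1 := hp.eq_add hq1
    have h2 : b = σ * (v + c σ * powDeriv q v - z) := by
      rw [← h1]; field_simp; ring
    linear_combination -h2
  have hv : σ * |v| ≤ |b| + σ * |z| := by
    calc σ * |v| ≤ σ * |b / σ + z| := mul_le_mul_of_nonneg_left (hp.abs_le hq1 h0) hpos.le
      _ = |b + σ * z| := by
        rw [← abs_of_pos hpos, ← abs_mul, abs_of_pos hpos]; congr 1; field_simp
      _ ≤ _ := by
        refine (abs_add_le _ _).trans ?_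
        rw [abs_mul, abs_of_pos hpos]
  rw [Real.dist_eq, e]
  refine (abs_add_le _ _).trans ?_
  rw [abs_neg, abs_mul, abs_mul, abs_mul, abs_of_nonneg h0, abs_of_pos hpos]
  refine add_le_add_left (mul_le_mul_of_nonneg_left ?_ h0) _
  calc σ * |powDeriv q v| ≤ σ * (q * (1 + |v|)) := by gcongr; exact abs_powDeriv_le hq1 hq2 v
    _ = q * (σ + σ * |v|) := by ring
    _ ≤ _ := by gcongr

lemma tendsto_integral_powDeriv_sq (hq1 : 1 < q) (hq2 : q < 2) (hε : ε ∈ Icc (0 : ℝ) 1)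
    (hG2 : Integrable (fun x => x ^ 2) g) (hη : ∀ u χ, 0 ≤ χ → IsProx q χ u (η u χ))
    (hc0 : ∀ᶠ σ in 𝓝[>] (0 : ℝ), 0 ≤ c σ) (hc : Tendsto c (𝓝[>] (0 : ℝ)) (𝓝 0)) :
    Tendsto (fun σ => σ ^ (2 * q - 2) *
        ∫ p, powDeriv q (η (p.1 / σ + p.2) (c σ)) ^ 2 ∂(jointLaw ε g))
      (𝓝[>] (0 : ℝ)) (𝓝 (∫ p, powDeriv q p.1 ^ 2 ∂(jointLaw ε g))) := by
  have hscale : ∀ σ > 0, ∀ x, powDeriv q (σ * x) ^ 2 = σ ^ (2 * q - 2) * powDeriv q x ^ 2 := by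
    intro σ hσ x
    rw [powDeriv_mul hσ, mul_pow, ← Real.rpow_mul_natCast hσ.le]
    congr 2
    push_cast
    ring
  have := isProbabilityMeasure_jointLaw (g := g) hε
  have hb := memLp_fst_jointLaw (ε := ε) hG2
  have hz := memLp_snd_jointLaw (g := g) hε
  have hD : Integrable (fun p : ℝ × ℝ => (q * (1 + (|p.1| + |p.2|))) ^ 2) (jointLaw ε g) :=
    (((memLp_const (1 : ℝ)).add (hb.abs.add hz.abs)).const_mul q).integrable_sq
  have key : Tendsto (fun σ => ∫ p, powDeriv q (σ * η (p.1 / σ + p.2) (c σ)) ^ 2 ∂(jointLaw ε g))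
      (𝓝[>] (0 : ℝ)) (𝓝 (∫ p, powDeriv q p.1 ^ 2 ∂(jointLaw ε g))) := by
    refine tendsto_integral_filter_of_dominated_convergence _ ?_ ?_ hD
      (Filter.Eventually.of_forall fun p => ?_)
    · filter_upwards [hc0] with σ h0
      have h1 := continuous_of_isProx hq1 h0 fun u => hη u (c σ) h0
      have h2 := continuous_powDeriv hq1 hq2
      refine Continuous.aestronglyMeasurable ((h2.comp (continuous_const.mul (h1.comp ?_))).pow 2)
      fun_prop
    · filter_upwards [hc0, Ioc_mem_nhdsGT (zero_lt_one (α := ℝ))] with σ h0 hσ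
      refine Filter.Eventually.of_forall fun p => ?_
      rw [Real.norm_eq_abs, abs_pow]
      have hσ0 : 0 < σ := hσ.1
      refine pow_le_pow_left₀ (abs_nonneg _) ((abs_powDeriv_le hq1 hq2 _).trans ?_) 2
      gcongr
      rw [abs_mul, abs_of_pos hσ0]
      calc σ * |_| ≤ σ * |p.1 / σ + p.2| :=
            mul_le_mul_of_nonneg_left ((hη _ _ h0).abs_le hq1 h0) hσ0.le
        _ = |p.1 + σ * p.2| := by
          rw [← abs_of_pos hσ0, ← abs_mul, abs_of_pos hσ0]; congr 1; field_simp
        _ ≤ |p.1| + σ * |p.2| := by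
          refine (abs_add_le _ _).trans ?_
          rw [abs_mul, abs_of_pos hσ0]
        _ ≤ _ := by
          have := mul_le_mul_of_nonneg_right hσ.2 (abs_nonneg p.2)
          linarith
    · exact (((continuous_powDeriv hq1 hq2).tendsto _).comp
        (tendsto_mul_prox hq1 hq2 hη hc0 hc p.1 p.2)).pow 2
  refine key.congr' ?_
  filter_upwards [self_mem_nhdsWithin] with σ hσ
  simp only [hscale σ hσ, integral_const_mul]

lemma tendsto_integral_mul_powDeriv (hq1 : 1 < q) (hq2 : q < 2) (hε : ε ∈ Icc (0 : ℝ) 1)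
    (hg0 : g {0} = 0) (hG2 : Integrable (fun x => x ^ 2) g)
    (hη : ∀ u χ, 0 ≤ χ → IsProx q χ u (η u χ))
    (hc0 : ∀ᶠ σ in 𝓝[>] (0 : ℝ), 0 ≤ c σ) (hc : Tendsto c (𝓝[>] (0 : ℝ)) (𝓝 0)) :
    Tendsto (fun σ => ∫ p, p.2 * powDeriv q (η (p.1 / σ + p.2) (c σ)) ∂(jointLaw ε g))
      (𝓝[>] (0 : ℝ)) (𝓝 ((1 - ε) * ∫ z, q * |z| ^ q ∂_root_.stdGaussian)) := by
  have := isProbabilityMeasure_mix hε g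
  have := isProbabilityMeasure_jointLaw (g := g) hε
  have hz := memLp_snd_jointLaw (g := g) hε
  have hψc := continuous_powDeriv hq1 hq2
  have hb2 : ∀ σ : ℝ, MemLp (fun p : ℝ × ℝ => p.1 / σ) 2 (jointLaw ε g) := fun σ => by
    simpa only [div_eq_inv_mul] using (memLp_fst_jointLaw (ε := ε) hG2).const_mul σ⁻¹
  have hfint : Integrable (fun z : ℝ => q * |z| ^ q) _root_.stdGaussian := by
    have h2 : MemLp (powDeriv q) 2 _root_.stdGaussian := by
      refine MemLp.of_le (((memLp_const (1 : ℝ)).add memLp_two_stdGaussian.abs).const_mul q)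
        hψc.aestronglyMeasurable (Filter.Eventually.of_forall fun z => ?_)
      exact (abs_powDeriv_le hq1 hq2 z).trans (le_abs_self _)
    have h3 : Integrable (fun z => z * powDeriv q z) _root_.stdGaussian :=
      memLp_two_stdGaussian.integrable_mul h2
    simpa only [powDeriv_mul_self hq1] using h3
  have hlimit := integral_ite_jointLaw hε hg0
    (by fun_prop : Measurable fun z : ℝ => q * |z| ^ q) hfint 0
  rw [mul_zero, add_zero] at hlimit
  have hD : Integrable (fun p : ℝ × ℝ => 3 * (|p.2| * (q * (1 + |p.2|)))) (jointLaw ε g) :=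
    (hz.abs.integrable_mul (((memLp_const (1 : ℝ)).add hz.abs).const_mul q)).const_mul 3
  have key : Tendsto (fun σ => ∫ p, p.2 * (powDeriv q (η (p.1 / σ + p.2) (c σ))
      - powDeriv q (η (p.1 / σ) (c σ))) ∂(jointLaw ε g)) (𝓝[>] (0 : ℝ))
      (𝓝 (∫ p, (if p.1 = 0 then q * |p.2| ^ q else 0) ∂(jointLaw ε g))) := by
    refine tendsto_integral_filter_of_dominated_convergence _ ?_ ?_ hD
      (Filter.Eventually.of_forall fun p => ?_)
    · filter_upwards [hc0] with σ h0
      have h1 := continuous_of_isProx hq1 h0 fun u => hη u (c σ) h0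
      refine Continuous.aestronglyMeasurable (continuous_snd.mul
        ((hψc.comp (h1.comp ?_)).sub (hψc.comp (h1.comp ?_)))) <;> fun_prop
    · filter_upwards [hc0] with σ h0
      refine Filter.Eventually.of_forall fun p => ?_
      rw [Real.norm_eq_abs, abs_mul]
      have h1 : |η (p.1 / σ + p.2) (c σ) - η (p.1 / σ) (c σ)| ≤ |p.2| := by
        simpa using (hη (p.1 / σ + p.2) _ h0).abs_sub_le hq1 h0 (hη (p.1 / σ) _ h0)
      calc _ ≤ |p.2| * (3 * q * |η (p.1 / σ + p.2) (c σ) - η (p.1 / σ) (c σ)| ^ (q - 1)) := by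
            gcongr; exact abs_powDeriv_sub_le_rpow hq1 hq2 _ _
        _ ≤ |p.2| * (3 * (q * |p.2| ^ (q - 1))) := by
          rw [mul_assoc]; gcongr
        _ ≤ |p.2| * (3 * (q * (1 + |p.2|))) := by
          rw [← abs_powDeriv hq1]; gcongr; exact abs_powDeriv_le hq1 hq2 _
        _ = _ := by ring
    · obtain ⟨b, z⟩ := p
      rcases eq_or_ne b 0 with rfl | hb
      · simp only [zero_div, zero_add, if_true]
        have h1 : Tendsto (fun σ => η z (c σ)) (𝓝[>] (0 : ℝ)) (𝓝 z) := by
          have hlim : Tendsto (fun σ => c σ * (q * (1 + |z|))) (𝓝[>] (0 : ℝ)) (𝓝 0) := by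
            simpa using hc.mul_const (q * (1 + |z|))
          refine tendsto_iff_dist_tendsto_zero.2 (squeeze_zero' (Filter.Eventually.of_forall
            fun _ => dist_nonneg) ?_ hlim)
          filter_upwards [hc0] with σ h0
          have hp := hη z (c σ) h0
          have e : η z (c σ) - z = -(c σ * powDeriv q (η z (c σ))) := by
            linarith [hp.eq_add hq1]
          rw [Real.dist_eq, e, abs_neg, abs_mul, abs_of_nonneg h0]
          refine mul_le_mul_of_nonneg_left ((abs_powDeriv_le hq1 hq2 _).trans ?_) h0
          have := hp.abs_le hq1 h0
          gcongr
        have h2 : Tendsto (fun σ => η 0 (c σ)) (𝓝[>] (0 : ℝ)) (𝓝 0) := by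
          refine tendsto_const_nhds.congr' ?_
          filter_upwards [hc0] with σ h0
          have := (hη 0 (c σ) h0).abs_le hq1 h0
          rw [abs_zero] at this
          exact (abs_nonpos_iff.1 this).symm
        have h3 := (((hψc.tendsto _).comp h1).sub ((hψc.tendsto _).comp h2)).const_mul z
        have h4 : powDeriv q 0 = 0 := by simp [powDeriv]
        rwa [h4, sub_zero, powDeriv_mul_self hq1] at h3
      · simp only [if_neg hb]
        have h1 : Tendsto (fun σ => |η (b / σ) (c σ)|) (𝓝[>] (0 : ℝ)) atTop := by
          have h2 := (tendsto_mul_prox hq1 hq2 hη hc0 hc b 0).abs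
          have h3 := Tendsto.atTop_mul_pos (abs_pos.2 hb) tendsto_inv_nhdsGT_zero h2
          refine h3.congr' ?_
          filter_upwards [self_mem_nhdsWithin] with σ hσ
          have hσ : 0 < σ := hσ
          rw [abs_mul, abs_of_pos hσ, add_zero]
          field_simp
        have h2 : Tendsto (fun σ => |z| * (2 * q * |z| * |η (b / σ) (c σ)| ^ (q - 2)))
            (𝓝[>] (0 : ℝ)) (𝓝 0) := by
          have h3 := (tendsto_rpow_neg_atTop (by linarith : 0 < 2 - q)).comp h1
          simpa [Function.comp_def] using (h3.const_mul (2 * q * |z|)).const_mul |z|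
        refine squeeze_zero_norm' ?_ h2
        filter_upwards [hc0, h1.eventually_gt_atTop 0] with σ h0 hpos
        rw [Real.norm_eq_abs, abs_mul]
        have h5 : |η (b / σ + z) (c σ) - η (b / σ) (c σ)| ≤ |z| := by
          simpa using (hη (b / σ + z) _ h0).abs_sub_le hq1 h0 (hη (b / σ) _ h0)
        refine mul_le_mul_of_nonneg_left
          ((abs_powDeriv_sub_le hq1 hq2 _ (abs_pos.1 hpos)).trans ?_) (abs_nonneg z)
        gcongr
  rw [hlimit] at key
  refine key.congr' ?_
  filter_upwards [hc0] with σ h0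
  have hη' := fun u => hη u (c σ) h0
  have i1 : Integrable (fun p : ℝ × ℝ => p.2 * powDeriv q (η (p.1 / σ + p.2) (c σ)))
      (jointLaw ε g) :=
    hz.integrable_mul (memLp_powDeriv_isProx hq1 hq2 hε h0 hη' (memLp_shift hε hG2 σ))
  have i2 : Integrable (fun p : ℝ × ℝ => p.2 * powDeriv q (η (p.1 / σ) (c σ)))
      (jointLaw ε g) :=
    hz.integrable_mul (memLp_powDeriv_isProx hq1 hq2 hε h0 hη' (hb2 σ))
  have hmean : ∫ z : ℝ, z ∂_root_.stdGaussian = 0 := integral_id_gaussianReal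
  have hzero : ∫ p, p.2 * powDeriv q (η (p.1 / σ) (c σ)) ∂(jointLaw ε g) = 0 := by
    have := integral_prod_mul (μ := mix ε g) (ν := _root_.stdGaussian)
      (fun b => powDeriv q (η (b / σ) (c σ))) (fun z : ℝ => z)
    rw [hmean, mul_zero] at this
    rw [← this, jointLaw]
    congr! 2 with p
    ring
  simp only [mul_sub]
  rw [integral_sub i1 i2, hzero, sub_zero]

lemma Rq_zero (hq1 : 1 < q) (hq2 : q < 2) (hε : ε ∈ Icc (0 : ℝ) 1)
    (hG2 : Integrable (fun x => x ^ 2) g) (hη : ∀ u, IsProx q 0 u (η u 0)) :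
    Rq η (mix ε g) 0 σ = ∫ p, p.2 ^ 2 ∂(jointLaw ε g) := by
  simp [Rq_expand hq1 hq2 hε hG2 le_rfl hη]

lemma integral_sq_le_of_Rq_le (hq1 : 1 < q) (hq2 : q < 2) (hε : ε ∈ Icc (0 : ℝ) 1)
    (hG2 : Integrable (fun x => x ^ 2) g) (hη : ∀ u χ, 0 ≤ χ → IsProx q χ u (η u χ))
    (hχ : 0 ≤ χ) (hle : Rq η (mix ε g) χ σ ≤ Rq η (mix ε g) 0 σ) :
    ∫ p, (χ * powDeriv q (η (p.1 / σ + p.2) χ)) ^ 2 ∂(jointLaw ε g)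
      ≤ 4 * ∫ p, p.2 ^ 2 ∂(jointLaw ε g) := by
  rw [Rq_zero hq1 hq2 hε hG2 fun u => hη u 0 le_rfl,
    Rq_eq_integral hq1 hq2 hε hG2 hχ fun u => hη u χ hχ] at hle
  have hz := memLp_snd_jointLaw (g := g) hε
  have hψ := (memLp_powDeriv_isProx hq1 hq2 hε hχ (fun u => hη u χ hχ)
    (memLp_shift hε hG2 σ)).const_mul χ
  have i1 : Integrable (fun p : ℝ × ℝ => (p.2 - χ * powDeriv q (η (p.1 / σ + p.2) χ)) ^ 2)
      (jointLaw ε g) := (hz.sub hψ).integrable_sq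
  calc _ ≤ ∫ p, (2 * p.2 ^ 2 + 2 * (p.2 - χ * powDeriv q (η (p.1 / σ + p.2) χ)) ^ 2)
        ∂(jointLaw ε g) := by
        refine integral_mono hψ.integrable_sq ((hz.integrable_sq.const_mul 2).add
          (i1.const_mul 2)) fun p => ?_
        simp only
        nlinarith [sq_nonneg (2 * p.2 - χ * powDeriv q (η (p.1 / σ + p.2) χ))]
    _ = 2 * ∫ p, p.2 ^ 2 ∂(jointLaw ε g)
        + 2 * ∫ p, (p.2 - χ * powDeriv q (η (p.1 / σ + p.2) χ)) ^ 2 ∂(jointLaw ε g) := by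
        rw [integral_add (hz.integrable_sq.const_mul 2) (i1.const_mul 2), integral_const_mul,
          integral_const_mul]
    _ ≤ _ := by linarith

lemma tendsto_zero_of_Rq_le (hq1 : 1 < q) (hq2 : q < 2) (hε : ε ∈ Ioc (0 : ℝ) 1)
    (hg0 : g {0} = 0) (hG2 : Integrable (fun x => x ^ 2) g)
    (hη : ∀ u χ, 0 ≤ χ → IsProx q χ u (η u χ))
    (hc0 : ∀ᶠ σ in 𝓝[>] (0 : ℝ), 0 ≤ c σ)
    (hle : ∀ᶠ σ in 𝓝[>] (0 : ℝ), Rq η (mix ε g) (c σ) σ ≤ Rq η (mix ε g) 0 σ) :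
    Tendsto c (𝓝[>] (0 : ℝ)) (𝓝 0) := by
  have hε' : ε ∈ Icc (0 : ℝ) 1 := ⟨hε.1.le, hε.2⟩
  have := isProbabilityMeasure_jointLaw (g := g) hε'
  refine tendsto_order.2 ⟨fun a ha => hc0.mono fun σ h => ha.trans_le h, fun δ hδ => ?_⟩
  set V := ∫ p, p.2 ^ 2 ∂(jointLaw ε g)
  have hV0 : 0 ≤ V := integral_nonneg fun p => sq_nonneg _
  set N := (4 * V + 1) / ε with hN
  have hN0 : 0 ≤ N := div_nonneg (by linarith) hε.1.le
  let m : ℝ → ℝ := fun u => min (δ * (q * (|u| / 2) ^ (q - 1))) (|u| / 2)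
  have hm0 : ∀ u, 0 ≤ m u := fun u => le_min (by positivity) (by positivity)
  have hmm : Measurable m := by unfold m; fun_prop
  have hmtop : Tendsto (fun x : ℝ => m x) (comap (fun x : ℝ => |x|) atTop) atTop := by
    have h1 : Tendsto (fun x : ℝ => |x| / 2) (comap (fun x : ℝ => |x|) atTop) atTop :=
      tendsto_comap.atTop_div_const two_pos
    have h2 := (((tendsto_rpow_atTop (by linarith : 0 < q - 1)).comp h1).const_mul_atTop
      (by linarith : 0 < q)).const_mul_atTop hδ
    exact tendsto_atTop.2 fun K => by
      filter_upwards [h2.eventually_ge_atTop K, h1.eventually_ge_atTop K] with x hx1 hx2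
        using le_min hx1 hx2
  let φ : ℝ → ℝ × ℝ → ℝ := fun σ p => if p.1 = 0 then 0 else min (m (p.1 / σ + p.2) ^ 2) N
  have hφm : ∀ σ, Measurable (φ σ) := fun σ =>
    Measurable.ite (measurable_fst (measurableSet_singleton 0)) measurable_const
      (((hmm.comp (by fun_prop : Measurable fun p : ℝ × ℝ => p.1 / σ + p.2)).pow_const 2).min
        measurable_const)
  have hφ0 : ∀ σ p, 0 ≤ φ σ p := fun σ p => by
    unfold φ; split_ifs
    · exact le_rfl
    · exact le_min (sq_nonneg _) hN0
  have hφN : ∀ σ p, φ σ p ≤ N := fun σ p => by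
    unfold φ; split_ifs
    · exact hN0
    · exact min_le_right _ _
  have hφb : ∀ σ, ∀ᵐ p ∂(jointLaw ε g), ‖φ σ p‖ ≤ N := fun σ =>
    Filter.Eventually.of_forall fun p => by
      rw [Real.norm_eq_abs, abs_of_nonneg (hφ0 σ p)]; exact hφN σ p
  have hlim : Tendsto (fun σ => ∫ p, φ σ p ∂(jointLaw ε g)) (𝓝[>] (0 : ℝ))
      (𝓝 (∫ p, (if p.1 = 0 then 0 else N) ∂(jointLaw ε g))) := by
    refine tendsto_integral_filter_of_dominated_convergence (fun _ => N)
      (Filter.Eventually.of_forall fun σ => (hφm σ).aestronglyMeasurable)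
      (Filter.Eventually.of_forall hφb) (integrable_const N)
      (Filter.Eventually.of_forall fun p => ?_)
    obtain ⟨b, z⟩ := p
    rcases eq_or_ne b 0 with rfl | hb
    · simp [φ]
    · simp only [φ, if_neg hb]
      have h1 : Tendsto (fun σ : ℝ => |b| * σ⁻¹ - |z|) (𝓝[>] (0 : ℝ)) atTop :=
        tendsto_atTop_add_const_right _ _
          (tendsto_inv_nhdsGT_zero.const_mul_atTop (abs_pos.2 hb))
      have h2 : Tendsto (fun σ : ℝ => |b / σ + z|) (𝓝[>] (0 : ℝ)) atTop := by
        refine tendsto_atTop_mono' _ ?_ h1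
        filter_upwards [self_mem_nhdsWithin] with σ hσ
        have hσ : 0 < σ := hσ
        have h3 := abs_sub_abs_le_abs_sub (b / σ) (-z)
        rw [abs_neg, sub_neg_eq_add, abs_div, abs_of_pos hσ, div_eq_mul_inv] at h3
        exact h3
      have h3 : Tendsto (fun σ : ℝ => m (b / σ + z)) (𝓝[>] (0 : ℝ)) atTop :=
        hmtop.comp (tendsto_comap_iff.2 h2)
      refine tendsto_const_nhds.congr' ?_
      filter_upwards [((tendsto_pow_atTop two_ne_zero).comp h3).eventually_ge_atTop N] with σ h
      exact (min_eq_right h).symm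
  rw [integral_ite_jointLaw hε' hg0 measurable_const (integrable_const 0)] at hlim
  have hεN : (1 - ε) * ∫ _, (0 : ℝ) ∂_root_.stdGaussian + ε * N = 4 * V + 1 := by
    rw [hN]; have := hε.1.ne'; simp; field_simp
  rw [hεN] at hlim
  filter_upwards [hc0, hle, hlim.eventually (lt_mem_nhds (by linarith : 4 * V < 4 * V + 1))]
    with σ h0 hR hgt
  by_contra! hcon
  have hbound := integral_sq_le_of_Rq_le hq1 hq2 hε' hG2 hη h0 hR
  have hψ := (memLp_powDeriv_isProx hq1 hq2 hε' h0 (fun u => hη u (c σ) h0)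
    (memLp_shift hε' hG2 σ)).const_mul (c σ)
  have hmono : ∫ p, φ σ p ∂(jointLaw ε g)
      ≤ ∫ p, (c σ * powDeriv q (η (p.1 / σ + p.2) (c σ))) ^ 2 ∂(jointLaw ε g) := by
    refine integral_mono (Integrable.mono' (integrable_const N)
      (hφm σ).aestronglyMeasurable (hφb σ)) hψ.integrable_sq fun p => ?_
    unfold φ
    split_ifs
    · exact sq_nonneg _
    · refine (min_le_left _ _).trans ?_
      rw [← sq_abs (c σ * _)]
      exact pow_le_pow_left₀ (hm0 _) ((hη _ _ h0).le_abs_mul_powDeriv hq1 h0 hcon) 2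
  linarith

end Joint

lemma tendsto_div_of_quadratic_le {ι : Type*} {l : Filter ι} {t α β α' β' : ι → ℝ} {a b : ℝ}
    (hb : 0 < b) (hα : Tendsto α l (𝓝 a)) (hβ : Tendsto β l (𝓝 b))
    (hα' : Tendsto α' l (𝓝 a)) (hβ' : Tendsto β' l (𝓝 b))
    (h : ∀ᶠ i in l, t i ^ 2 * β i - 2 * t i * α i
      ≤ (a / b) ^ 2 * β' i - 2 * (a / b) * α' i) :
    Tendsto t l (𝓝 (a / b)) := by
  have hr : Tendsto (fun i => α i / β i) l (𝓝 (a / b)) := hα.div hβ hb.ne'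
  have hE : Tendsto (fun i => ((a / b) ^ 2 * β' i - 2 * (a / b) * α' i + α i ^ 2 / β i) / β i) l
      (𝓝 0) := by
    have := (((hβ'.const_mul ((a / b) ^ 2)).sub (hα'.const_mul (2 * (a / b)))).add
      ((hα.pow 2).div hβ hb.ne')).div hβ hb.ne'
    have h0 : ((a / b) ^ 2 * b - 2 * (a / b) * a + a ^ 2 / b) / b = 0 := by
      field_simp
      ring
    rwa [h0] at this
  have hsq : Tendsto (fun i => (t i - α i / β i) ^ 2) l (𝓝 0) := by
    refine squeeze_zero' (Filter.Eventually.of_forall fun i => sq_nonneg _) ?_ hE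
    filter_upwards [h, hβ.eventually (lt_mem_nhds hb)] with i hi hβi
    rw [le_div_iff₀ hβi]
    have e : (t i - α i / β i) ^ 2 * β i
        = t i ^ 2 * β i - 2 * t i * α i + α i ^ 2 / β i := by
      field_simp
      ring
    linarith
  have hdiff : Tendsto (fun i => t i - α i / β i) l (𝓝 0) := by
    have h1 := hsq.sqrt
    simp only [Real.sqrt_sq_eq_abs, Real.sqrt_zero] at h1
    exact (tendsto_zero_iff_abs_tendsto_zero _).2 h1
  simpa using hdiff.add hr

/-- If `P(|G| ≤ t) = O(t)` as `t → 0` and `E[G²] < ∞`, then for `q ∈ (1,2)`: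
`χ*_q(σ)/σ^{2q−2} → (1−ε)E|Z|^q/(εq·E|G|^{2q−2})` as `σ → 0⁺`, where `χ*_q(σ)` is the
smallest minimizer of `χ ↦ R_q(χ,σ)` over `[0,∞)` (which exists for small `σ`). -/
theorem chi_star_q_rate
    (q ε : ℝ) (hq1 : 1 < q) (hq2 : q < 2) (hε : ε ∈ Ioo (0:ℝ) 1)
    (g : Measure ℝ) [IsProbabilityMeasure g] (hg0 : g {0} = 0)
    (hG2 : Integrable (fun x => x^2) g)
    (hGsmall : (fun t => (g {x : ℝ | |x| ≤ t}).toReal)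
      =O[nhdsWithin (0:ℝ) (Ioi 0)] (fun t => t))
    (η : ℝ → ℝ → ℝ) (hη : ∀ u χ, 0 ≤ χ → IsProx q χ u (η u χ))
    (χstar : ℝ → ℝ)
    (hχstar : ∀ᶠ σ in nhdsWithin (0:ℝ) (Ioi 0),
      χstar σ ∈ Ici (0:ℝ) ∧
      IsMinOn (fun χ => Rq η (mix ε g) χ σ) (Ici 0) (χstar σ) ∧
      ∀ χ' ∈ Ici (0:ℝ), IsMinOn (fun χ => Rq η (mix ε g) χ σ) (Ici 0) χ' → χstar σ ≤ χ') :
    Tendsto (fun σ => χstar σ / σ ^ (2*q - 2)) (nhdsWithin (0:ℝ) (Ioi 0))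
      (nhds ((1 - ε) * (∫ z, |z| ^ q ∂stdGaussian) /
        (ε * q * ∫ x, |x| ^ (2*q - 2) ∂g))) := by

  have hεc : ε ∈ Icc (0 : ℝ) 1 := ⟨hε.1.le, hε.2.le⟩
  have hsq : Integrable (fun x => powDeriv q x ^ 2) g := by
    have hid : MemLp (fun b : ℝ => b) 2 g :=
      (memLp_two_iff_integrable_sq aestronglyMeasurable_id).2 hG2
    refine MemLp.integrable_sq (MemLp.of_le (((memLp_const (1 : ℝ)).add hid.abs).const_mul q)
      (continuous_powDeriv hq1 hq2).aestronglyMeasurable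
      (Filter.Eventually.of_forall fun z => ?_))
    exact (abs_powDeriv_le hq1 hq2 z).trans (le_abs_self _)
  have hmoment : Integrable (fun x : ℝ => |x| ^ (2 * q - 2)) g := by
    have h := hsq.const_mul (q ^ 2)⁻¹
    simp only [powDeriv_sq hq1] at h
    refine h.congr (Filter.Eventually.of_forall fun x => ?_)
    simp only
    field_simp
  set M := ∫ x, |x| ^ (2 * q - 2) ∂g
  set A := ∫ z, |z| ^ q ∂_root_.stdGaussian
  have hM0 : 0 < M := by
    refine (integral_pos_iff_support_of_nonneg (fun x => by positivity) hmoment).2 ?_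
    have hsupp : ({0} : Set ℝ)ᶜ ⊆ Function.support fun x : ℝ => |x| ^ (2 * q - 2) :=
      fun x hx => (Real.rpow_pos_of_pos (abs_pos.2 hx) _).ne'
    refine lt_of_lt_of_le ?_ (measure_mono hsupp)
    rw [(prob_compl_eq_one_iff (measurableSet_singleton 0)).2 hg0]
    exact one_pos
  have hA0 : 0 ≤ A := integral_nonneg fun z => by positivity
  have hβ0 : ∫ p, powDeriv q p.1 ^ 2 ∂(jointLaw ε g) = ε * (q ^ 2 * M) := by
    have := isProbabilityMeasure_mix hεc g
    have h1 := integral_prod_mul (μ := mix ε g) (ν := _root_.stdGaussian)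
      (fun b => powDeriv q b ^ 2) (fun _ => (1 : ℝ))
    simp only [mul_one, integral_const, probReal_univ, smul_eq_mul] at h1
    rw [jointLaw, h1, integral_mix hεc hsq]
    simp only [powDeriv_sq hq1, integral_const_mul]
    rw [abs_zero, Real.zero_rpow (by linarith : 2 * q - 2 ≠ 0)]
    ring
  have hα0 : (1 - ε) * ∫ z, q * |z| ^ q ∂_root_.stdGaussian = (1 - ε) * (q * A) := by
    rw [integral_const_mul]
  set a := (1 - ε) * (q * A)
  set b := ε * (q ^ 2 * M)
  have ha : 0 ≤ a := mul_nonneg (by linarith [hε.2]) (by positivity)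
  have hb : 0 < b := mul_pos hε.1 (by positivity)
  have hval : (1 - ε) * A / (ε * q * M) = a / b := by
    have := hε.1.ne'
    simp only [a, b]
    field_simp
  rw [hval]
  have hs : Tendsto (fun σ : ℝ => σ ^ (2 * q - 2)) (𝓝[>] (0 : ℝ)) (𝓝 0) := by
    have h := (Real.continuousAt_rpow_const 0 (2 * q - 2) (Or.inr (by linarith))).tendsto
    rw [Real.zero_rpow (by linarith)] at h
    exact tendsto_nhdsWithin_of_tendsto_nhds h
  have hc0 : ∀ᶠ σ in 𝓝[>] (0 : ℝ), 0 ≤ χstar σ := hχstar.mono fun σ h => h.1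
  have hc : Tendsto χstar (𝓝[>] (0 : ℝ)) (𝓝 0) :=
    tendsto_zero_of_Rq_le hq1 hq2 ⟨hε.1, hε.2.le⟩ hg0 hG2 hη hc0
      (hχstar.mono fun σ h => h.2.1 (mem_Ici.2 le_rfl))
  have hd0 : ∀ᶠ σ in 𝓝[>] (0 : ℝ), 0 ≤ a / b * σ ^ (2 * q - 2) := by
    filter_upwards [self_mem_nhdsWithin] with σ hσ
    have hσ : 0 < σ := hσ
    positivity
  have hd : Tendsto (fun σ : ℝ => a / b * σ ^ (2 * q - 2)) (𝓝[>] (0 : ℝ)) (𝓝 0) := by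
    simpa using hs.const_mul (a / b)
  have hα := tendsto_integral_mul_powDeriv hq1 hq2 hεc hg0 hG2 hη hc0 hc
  have hα' := tendsto_integral_mul_powDeriv hq1 hq2 hεc hg0 hG2 hη hd0 hd
  have hβ := tendsto_integral_powDeriv_sq hq1 hq2 hεc hG2 hη hc0 hc
  have hβ' := tendsto_integral_powDeriv_sq hq1 hq2 hεc hG2 hη hd0 hd
  rw [hα0] at hα hα'
  rw [hβ0] at hβ hβ'
  refine tendsto_div_of_quadratic_le hb hα hβ hα' hβ' ?_
  filter_upwards [hχstar, hc0, hd0, self_mem_nhdsWithin] with σ hmin h0 h0' hσ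
  have hs0 : 0 < σ ^ (2 * q - 2) := Real.rpow_pos_of_pos hσ _
  have hle : Rq η (mix ε g) (χstar σ) σ ≤ Rq η (mix ε g) (a / b * σ ^ (2 * q - 2)) σ :=
    hmin.2.1 (mem_Ici.2 h0')
  rw [Rq_expand hq1 hq2 hεc hG2 h0 fun u => hη u _ h0,
    Rq_expand hq1 hq2 hεc hG2 h0' fun u => hη u _ h0'] at hle
  refine le_of_mul_le_mul_right ?_ hs0
  have e1 : χstar σ = χstar σ / σ ^ (2 * q - 2) * σ ^ (2 * q - 2) :=
    (div_mul_cancel₀ _ hs0.ne').symm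
  generalize ∫ p, powDeriv q (η (p.1 / σ + p.2) (χstar σ)) ^ 2 ∂(jointLaw ε g) = I₁ at hle ⊢
  generalize ∫ p, p.2 * powDeriv q (η (p.1 / σ + p.2) (χstar σ)) ∂(jointLaw ε g) = I₂ at hle ⊢
  rw [e1] at hle
  linarith
end
end

section
/- Let q be a constant with 1 < q ≤ 2. For any x, r ∈ ℝ there exists a number μ ∈ [0,1] such that |x + r|^q − |x|^q − q·r·|x|^{q−1}·sign(x) ≥ (q(q−1)/2)·|x + μr|^{q−2}·r², where the right-hand side is interpreted as 0 when r = 0. -/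
open Real Set

noncomputable section

lemma abs_rpow_sub_two_mul_self (q x : ℝ) :
    |x| ^ (q - 2) * x = |x| ^ (q - 1) * Real.sign x := by
  rcases lt_trichotomy x 0 with hx | rfl | hx
  · rw [Real.sign_of_neg hx, show q - 1 = q - 2 + 1 by ring,
      rpow_add_one (abs_pos.2 hx.ne).ne', abs_of_neg hx]
    ring
  · simp
  · rw [Real.sign_of_pos hx, show q - 1 = q - 2 + 1 by ring,
      rpow_add_one (abs_pos.2 hx.ne').ne', abs_of_pos hx]
    ring

/-- On `[0, M]` the slope of `y ↦ y ^ p`, `0 < p ≤ 1`, is at least its derivative at `M`. -/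
lemma monotoneOn_rpow_sub_deriv_mul {p M : ℝ} (hp0 : 0 < p) (hp1 : p ≤ 1) :
    MonotoneOn (fun y : ℝ => y ^ p - p * M ^ (p - 1) * y) (Icc 0 M) := by
  refine monotoneOn_of_hasDerivWithinAt_nonneg
    (f' := fun y => p * y ^ (p - 1) - p * M ^ (p - 1)) (convex_Icc 0 M) ?_ ?_ ?_
  · exact ((continuous_rpow_const hp0.le).sub (continuous_const.mul continuous_id)).continuousOn
  · intro y hy
    rw [interior_Icc] at hy
    have h := (hasDerivAt_rpow_const (p := p) (Or.inl hy.1.ne')).sub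
      ((hasDerivAt_id y).const_mul (p * M ^ (p - 1)))
    exact (h.congr_deriv (by ring)).hasDerivWithinAt
  · intro y hy
    rw [interior_Icc] at hy
    have h := rpow_le_rpow_of_nonpos hy.1 hy.2.le (by linarith : p - 1 ≤ 0)
    have := mul_le_mul_of_nonneg_left h hp0.le
    linarith

lemma MonotoneOn.Icc_neg_of_odd {f : ℝ → ℝ} {M : ℝ} (hodd : ∀ y, f (-y) = -f y)
    (hf : MonotoneOn f (Icc 0 M)) : MonotoneOn f (Icc (-M) M) := by
  intro a ha b hb hab
  have h0 : f 0 = 0 := by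
    have := hodd 0
    rw [neg_zero] at this
    linarith
  have hM : 0 ≤ M := by linarith [ha.1, ha.2]
  rcases le_total 0 a with h | h
  · exact hf ⟨h, ha.2⟩ ⟨h.trans hab, hb.2⟩ hab
  rcases le_total b 0 with h' | h'
  · have := hf (a := -b) ⟨by linarith, by linarith [hb.1]⟩ (b := -a)
      ⟨by linarith, by linarith [ha.1]⟩ (by linarith)
    rw [hodd, hodd] at this
    linarith
  · have h1 := hf ⟨le_rfl, hM⟩ ⟨h', hb.2⟩ h'
    have h2 := hf (b := -a) ⟨le_rfl, hM⟩ ⟨by linarith, by linarith [ha.1]⟩ (by linarith)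
    rw [hodd] at h2
    linarith

lemma monotoneOn_abs_rpow_sub_two_mul_self_sub {q M : ℝ} (hq1 : 1 < q) (hq2 : q ≤ 2) :
    MonotoneOn (fun y : ℝ => |y| ^ (q - 2) * y - (q - 1) * M ^ (q - 2) * y) (Icc (-M) M) := by
  refine MonotoneOn.Icc_neg_of_odd (fun y => by simp only [abs_neg]; ring) ?_
  refine (monotoneOn_rpow_sub_deriv_mul (p := q - 1) (by linarith) (by linarith)).congr ?_
  intro y hy
  rcases hy.1.eq_or_lt with rfl | h
  · simp [zero_rpow (by linarith : q - 1 ≠ 0)]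
  · simp only [abs_of_pos h]
    rw [show q - 1 = q - 2 + 1 by ring, rpow_add_one h.ne']
    ring_nf

/-- Second-order lower Taylor bound for `|·| ^ q` on `[-M, M]`: there the second derivative is
smallest at the endpoints. -/
lemma abs_rpow_taylor_lower_bound_of_abs_le {q M x r : ℝ} (hq1 : 1 < q) (hq2 : q ≤ 2)
    (hx : |x| ≤ M) (hxr : |x + r| ≤ M) :
    q * (q - 1) / 2 * M ^ (q - 2) * r ^ 2
      ≤ |x + r| ^ q - |x| ^ q - q * r * |x| ^ (q - 1) * Real.sign x := by
  set h : ℝ → ℝ := fun y => |y| ^ (q - 2) * y - (q - 1) * M ^ (q - 2) * y with hh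
  have hmono : MonotoneOn h (Icc (-M) M) := monotoneOn_abs_rpow_sub_two_mul_self_sub hq1 hq2
  have hderiv : ∀ t : ℝ, HasDerivAt
      (fun t : ℝ => |x + t * r| ^ q - q * (q - 1) / 2 * M ^ (q - 2) * (x + t * r) ^ 2)
      (q * h (x + t * r) * r) t := by
    intro t
    have hl : HasDerivAt (fun t : ℝ => x + t * r) r t := by
      simpa using ((hasDerivAt_id t).mul_const r).const_add x
    have h1 := (hasDerivAt_abs_rpow (x + t * r) hq1).comp t hl
    have h2 := (hl.pow 2).const_mul (q * (q - 1) / 2 * M ^ (q - 2))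
    refine (h1.sub h2).congr_deriv ?_
    simp only [hh]
    push_cast
    ring
  obtain ⟨t, ht, hslope⟩ := exists_hasDerivAt_eq_slope _ _ (zero_lt_one (α := ℝ))
    (fun t _ => (hderiv t).continuousAt.continuousWithinAt) (fun t _ => hderiv t)
  have hx' := abs_le.1 hx
  have hxr' := abs_le.1 hxr
  have hmem : x + t * r ∈ Icc (-M) M := by
    have : x + t * r = (1 - t) • x + t • (x + r) := by simp only [smul_eq_mul]; ring
    rw [this]
    exact convex_Icc (-M) M hx' hxr' (by linarith [ht.2]) ht.1.le (by ring)
  have key : h x * r ≤ h (x + t * r) * r := by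
    rcases le_total 0 r with hr | hr
    · exact mul_le_mul_of_nonneg_right
        (hmono hx' hmem (by nlinarith [ht.1])) hr
    · exact mul_le_mul_of_nonpos_right
        (hmono hmem hx' (by nlinarith [ht.1])) hr
  have key' := mul_le_mul_of_nonneg_left key (by linarith : 0 ≤ q)
  rw [← mul_assoc q (h (x + t * r)) r, hslope] at key'
  have hs := abs_rpow_sub_two_mul_self q x
  simp only [hh, hs, one_mul, zero_mul, add_zero, sub_zero, div_one] at key'
  linarith

/-- For `1 < q ≤ 2` and any `x, r ∈ ℝ` there exists `μ ∈ [0,1]` such that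
`|x+r|^q − |x|^q − q·r·|x|^{q−1}·sign(x) ≥ (q(q−1)/2)·|x+μr|^{q−2}·r²`
(the right-hand side being `0` when `r = 0`, as `r² = 0` then). -/
theorem abs_rpow_taylor_lower_bound
    (q : ℝ) (hq1 : 1 < q) (hq2 : q ≤ 2) (x r : ℝ) :
    ∃ μ ∈ Icc (0:ℝ) 1,
      (q * (q - 1) / 2) * |x + μ * r| ^ (q - 2) * r ^ 2
        ≤ |x + r| ^ q - |x| ^ q - q * r * |x| ^ (q - 1) * Real.sign x := by
  rcases le_total |x| |x + r| with h | h
  · refine ⟨1, by simp, ?_⟩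
    rw [one_mul]
    exact abs_rpow_taylor_lower_bound_of_abs_le hq1 hq2 h le_rfl
  · refine ⟨0, by simp, ?_⟩
    rw [zero_mul, add_zero]
    exact abs_rpow_taylor_lower_bound_of_abs_le hq1 hq2 le_rfl h
end
end
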